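/- For the normalized ultraspherical polynomials y_n with λ > -1/2 and the value θ = 4/(2-λ) if -1/2 < λ ≤ 0, θ = 2/(1+2λ) if λ ≥ 0, the Turán-type inequality |x|^θ y_n(x)² - y_{n-1}(x) y_{n+1}(x) ≥ 0 holds for all n ≥ 1 and all x with |x| ≤ 1. -/

import Mathlib

lemma turan_key_pos (l m c : ℝ) (hl : 0 < l) (hm : l ≤ m) (hc0 : 0 < c) (hc1 : c ≤ 1)
    (hc : (m+1)^2*(1-c^2) ≤ l^2) :
    (m+l)*((m+1)*c+√(l^2-(m+1)^2*(1-c^2))) ≤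
      c^(1/l) * ((m+1+l) * (m*c+√(l^2-m^2*(1-c^2)))) := by
  have hm0 : 0 < m := by linarith
  have hpos : ∀ k : ℝ, 0 < k → ∀ t : ℝ, 0 < t → 0 < k*t+√(l^2-k^2*(1-t^2)) := by
    intro k hk t ht
    have := Real.sqrt_nonneg (l^2-k^2*(1-t^2))
    have := mul_pos hk ht
    linarith
  let φ : ℝ → ℝ := fun t => (1/l) * Real.log t + Real.log (m*t+√(l^2-m^2*(1-t^2)))
    - Real.log ((m+1)*t+√(l^2-(m+1)^2*(1-t^2)))
  have hd : ∀ k : ℝ, 0 < k → ∀ t : ℝ, 0 < t → 0 < l^2-k^2*(1-t^2) →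
      HasDerivAt (fun t => Real.log (k*t+√(l^2-k^2*(1-t^2)))) (k/√(l^2-k^2*(1-t^2))) t := by
    intro k hk t ht h
    have hs : 0 < √(l^2-k^2*(1-t^2)) := Real.sqrt_pos.2 h
    have h1 : HasDerivAt (fun t : ℝ => l^2-k^2*(1-t^2)) (2*k^2*t) t := by
      have := (((hasDerivAt_pow 2 t).const_sub 1).const_mul (k^2)).const_sub (l^2)
      refine this.congr_deriv ?_
      simp
      ring
    have h2 := h1.sqrt h.ne'
    have h3 : HasDerivAt (fun t : ℝ => k*t) k t := by
      simpa using (hasDerivAt_id t).const_mul k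
    have h4 := (h3.fun_add h2).log (hpos k hk t ht).ne'
    refine h4.congr_deriv ?_
    have h5 := (hpos k hk t ht).ne'
    rw [mul_assoc, mul_div_mul_left _ _ (two_ne_zero), div_eq_div_iff h5 hs.ne', add_mul, div_mul_cancel₀ _ hs.ne']
    ring
  have hanti : AntitoneOn φ (Set.Icc c 1) := by
    have hstrict : ∀ t ∈ Set.Ioo c 1, 0 < l^2-(m+1)^2*(1-t^2) ∧
        l^2-(m+1)^2*(1-t^2) ≤ l^2-m^2*(1-t^2) ∧ l^2-m^2*(1-t^2) ≤ (l*t)^2 := by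
      rintro t ⟨h1, h2⟩
      have ht : 0 < t := hc0.trans h1
      have h3 : c^2 < t^2 := by nlinarith
      have h4 : 0 < 1 - t^2 := by nlinarith
      refine ⟨by nlinarith [mul_pos (sub_pos.2 h3) (by positivity : 0 < (m+1)^2)], ?_, ?_⟩
      · nlinarith
      · have : l^2 ≤ m^2 := by nlinarith
        nlinarith
    have hder : ∀ t ∈ Set.Ioo c 1, HasDerivAt φ ((1/l) * t⁻¹ + m/√(l^2-m^2*(1-t^2))
        - (m+1)/√(l^2-(m+1)^2*(1-t^2))) t := by
      intro t ht
      obtain ⟨a1, a2, a3⟩ := hstrict t ht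
      have ht0 : 0 < t := hc0.trans ht.1
      exact (((Real.hasDerivAt_log ht0.ne').const_mul (1/l)).add
        (hd m hm0 t ht0 (a1.trans_le a2))).sub (hd (m+1) (by linarith) t ht0 a1)
    apply antitoneOn_of_deriv_nonpos (convex_Icc c 1)
    · have hc' : ∀ k : ℝ, 0 < k → ContinuousOn (fun t => Real.log (k*t+√(l^2-k^2*(1-t^2)))) (Set.Icc c 1) := by
        intro k hk
        apply ContinuousOn.log
        · fun_prop
        · intro t ht
          exact (hpos k hk t (hc0.trans_le ht.1)).ne'
      refine ContinuousOn.sub (ContinuousOn.add (ContinuousOn.mul continuousOn_const ?_) (hc' m hm0)) (hc' (m+1) (by linarith))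
      exact ContinuousOn.log continuousOn_id (fun t ht => (hc0.trans_le ht.1).ne')
    · rw [interior_Icc]
      intro t ht
      exact (hder t ht).differentiableAt.differentiableWithinAt
    · rw [interior_Icc]
      intro t ht
      rw [(hder t ht).deriv]
      obtain ⟨a1, a2, a3⟩ := hstrict t ht
      have ht0 : 0 < t := hc0.trans ht.1
      have b1 := Real.sqrt_pos.2 a1
      have b2 := Real.sqrt_le_sqrt a2
      have b3 : √(l^2-m^2*(1-t^2)) ≤ l*t := Real.sqrt_le_iff.2 ⟨by positivity, a3⟩
      have b4 := b1.trans_le b2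
      have c1 : (m+1)/√(l^2-m^2*(1-t^2)) ≤ (m+1)/√(l^2-(m+1)^2*(1-t^2)) := by gcongr
      have c2 : 1/(l*t) ≤ 1/√(l^2-m^2*(1-t^2)) := by gcongr
      have c3 : (1/l)*t⁻¹ = 1/(l*t) := by field_simp
      rw [c3]
      rw [add_div] at c1
      linarith
  have h := hanti (Set.left_mem_Icc.2 hc1) (Set.right_mem_Icc.2 hc1) hc1
  have hone : φ 1 = Real.log (m+l) - Real.log (m+1+l) := by
    simp [φ, Real.sqrt_sq hl.le]
  rw [hone] at h
  simp only [φ] at h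
  have p1 := hpos m hm0 c hc0
  have p2 := hpos (m+1) (by linarith) c hc0
  rw [← Real.log_rpow hc0] at h
  have p3 : 0 < c^(1/l) := Real.rpow_pos_of_pos hc0 _
  rw [← Real.log_le_log_iff (by positivity) (by positivity), Real.log_mul (by positivity) p2.ne',
    Real.log_mul p3.ne' (by positivity), Real.log_mul (by positivity) p1.ne']
  linarith

set_option maxHeartbeats 1600000 in
lemma turan_key_neg (μ m c : ℝ) (hl : 0 < μ) (hl2 : μ < 1/2) (hm : μ ≤ m) (hc0 : 0 < c) (hc1 : c ≤ 1)
    (hc : (m+1)^2*(1-c^2) ≤ μ^2) :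
    (m-μ)*((m+1)*c+√(μ^2-(m+1)^2*(1-c^2))) ≤
      c^(4/μ) * ((m+1-μ) * (m*c+√(μ^2-m^2*(1-c^2)))) := by
  have hb : 1 - 2*(1-c^2)/μ ≤ c^(4/μ) := by
    have h := one_add_mul_self_le_rpow_one_add (s := c^2-1) (by nlinarith) (p := 2/μ)
      (by rw [le_div_iff₀ hl]; linarith)
    have e : (1 + (c^2-1))^(2/μ) = c^(4/μ) := by
      rw [show 1 + (c^2-1) = c^(2:ℝ) by rw [Real.rpow_two]; ring, ← Real.rpow_mul hc0.le]
      congr 1; ring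
    rw [e] at h
    refine le_trans (le_of_eq ?_) h
    ring
  obtain ⟨ε, hε⟩ : ∃ ε, 1 - c^2 = μ^2*ε := ⟨(1-c^2)/μ^2, by field_simp⟩
  have hε0 : 0 ≤ ε := by
    by_contra! h
    nlinarith [mul_pos (pow_pos hl 2) (neg_pos.2 h)]
  rw [hε] at hb hc ⊢
  have hε1 : (m+1)^2*ε ≤ 1 := by
    by_contra! h
    nlinarith [mul_pos (pow_pos hl 2) (sub_pos.2 h)]
  have hs : ∀ k : ℝ, √(μ^2-k^2*(μ^2*ε)) = μ * √(1-k^2*ε) := by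
    intro k
    rw [show μ^2-k^2*(μ^2*ε) = μ^2*(1-k^2*ε) by ring, Real.sqrt_mul (by positivity), Real.sqrt_sq hl.le]
  rw [hs, hs]
  have hm0 : 0 < m := by linarith
  have hmε : m^2*ε ≤ 1 := by nlinarith
  set s := √(1-m^2*ε) with hsd
  set S := √(1-(m+1)^2*ε) with hSd
  have s0 : 0 ≤ s := Real.sqrt_nonneg _
  have S0 : 0 ≤ S := Real.sqrt_nonneg _
  have s2 : s^2 = 1-m^2*ε := Real.sq_sqrt (by linarith)
  have S2 : S^2 = 1-(m+1)^2*ε := Real.sq_sqrt (by linarith)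
  have s1 : s ≤ 1 := by nlinarith [mul_nonneg (sq_nonneg m) hε0]
  have sS : S ≤ s := Real.sqrt_le_sqrt (by nlinarith)
  have sv : 1 - m^2*ε ≤ s := by nlinarith
  have hdiff : (2*m+1)*ε/2 ≤ s - S := by
    have : (s-S)*(s+S) = (2*m+1)*ε := by nlinarith
    nlinarith
  have hb' : 1 - 2*μ*ε ≤ c^(4/μ) := by
    refine le_trans (le_of_eq ?_) hb
    field_simp
  have hX : 0 ≤ (m+1-μ)*(m*c+μ*s) := by
    apply mul_nonneg (by linarith); positivity
  refine le_trans ?_ (mul_le_mul_of_nonneg_right hb' hX)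
  -- reduce to E ≥ 0
  have hE : 2*ε*((m+1-μ)*(m*c+μ*s)) ≤ c + s + (m-μ)*((2*m+1)*ε/2) := by
    have e1 : ε*(m+1) ≤ 1 := by nlinarith
    have e2 : 2*ε*μ*(m+1-μ) ≤ 1 := by
      have : ε*(m+1-μ) ≤ 1 := by nlinarith
      nlinarith [mul_nonneg hε0 (by linarith : 0 ≤ m+1-μ)]
    have hr : 0 ≤ (m-μ)*((2*m+1)*ε/2) := mul_nonneg (by linarith) (by positivity)
    have e3 : 0 ≤ s*(1-2*ε*μ*(m+1-μ)) := mul_nonneg s0 (by linarith)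
    by_cases hcc : 0 ≤ 1 - 2*ε*(m+1-μ)*m
    · nlinarith [mul_nonneg hc0.le hcc]
    · push Not at hcc
      have e4 : (1-m^2*ε)*(1-2*ε*μ*(m+1-μ)) ≤ s*(1-2*ε*μ*(m+1-μ)) :=
        mul_le_mul_of_nonneg_right sv (by linarith)
      have e5 : 1 - 2*ε*(m+1-μ)*m ≤ c*(1 - 2*ε*(m+1-μ)*m) := by
        linarith [mul_nonneg (sub_nonneg.2 hc1) (neg_nonneg.2 hcc.le)]
      have e6 : 0 ≤ 2*ε^2*μ*m^2*(m+1-μ) := mul_nonneg (by positivity) (by linarith)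
      have e7 : 0 ≤ ε*(2.5*m+2-μ*m-2.5*μ+2*μ^2) := mul_nonneg hε0 (by
        have : 0 ≤ (2.5-μ)*m := mul_nonneg (by linarith) hm0.le
        have := sq_nonneg μ
        linarith)
      linarith
  have h1 : 0 ≤ (m-μ)*((s-S)-(2*m+1)*ε/2) := mul_nonneg (by linarith) (by linarith)
  linarith [mul_le_mul_of_nonneg_left hE hl.le, mul_nonneg hl.le h1]

/-- conversion to the variables `x`, `q` -/
lemma turan_conv (l m x q s c : ℝ) (hs : 0 < s) (hq : q = s^2) (hx : x = s*c) :
    √(m^2*x^2-(m^2-l^2)*q) = s*√(l^2-m^2*(1-c^2)) := by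
  rw [show m^2*x^2-(m^2-l^2)*q = s^2*(l^2-m^2*(1-c^2)) by rw [hq, hx]; ring,
    Real.sqrt_mul (by positivity), Real.sqrt_sq hs.le]

lemma turan_key (l m x θ : ℝ) (hl : -1/2 < l) (hl0 : l ≠ 0) (hm : |l| ≤ m)
    (hθneg : l ≤ 0 → θ = 4 / (2 - l)) (hθpos : 0 ≤ l → θ = 2 / (1 + 2 * l))
    (hx0 : 0 < x) (hx1 : x ≤ 1) (hcrit : 0 ≤ (m+1)^2*x^2-((m+1)^2-l^2)*x^θ) :
    (m+l)*((m+1)*x+√((m+1)^2*x^2-((m+1)^2-l^2)*x^θ)) ≤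
      x^θ * ((m+1+l)*(m*x+√(m^2*x^2-(m^2-l^2)*x^θ))) := by
  have hs : 0 < x^(θ/2) := Real.rpow_pos_of_pos hx0 _
  have hc0 : 0 < x^(1-θ/2) := Real.rpow_pos_of_pos hx0 _
  have hq : x^θ = (x^(θ/2))^2 := by
    rw [← Real.rpow_natCast, ← Real.rpow_mul hx0.le]; norm_num
  have hxx : x = x^(θ/2)*x^(1-θ/2) := by
    rw [← Real.rpow_add hx0]; norm_num
  have hθ2 : θ ≤ 2 := by
    rcases le_total l 0 with h | h
    · rw [hθneg h, div_le_iff₀ (by linarith)]; linarith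
    · rw [hθpos h, div_le_iff₀ (by linarith)]; linarith
  have hc1 : x^(1-θ/2) ≤ 1 := Real.rpow_le_one hx0.le hx1 (by linarith)
  have hcc : (m+1)^2*(1-(x^(1-θ/2))^2) ≤ l^2 := by
    have : (m+1)^2*x^2-((m+1)^2-l^2)*x^θ = (x^(θ/2))^2*(l^2-(m+1)^2*(1-(x^(1-θ/2))^2)) := by
      rw [hq]; nth_rewrite 1 [hxx]; ring
    rw [this] at hcrit
    have := nonneg_of_mul_nonneg_right hcrit (by positivity)
    linarith
  rw [turan_conv l (m+1) x _ _ _ hs hq hxx, turan_conv l m x _ _ _ hs hq hxx]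
  have main : (m+l)*((m+1)*x^(1-θ/2)+√(l^2-(m+1)^2*(1-(x^(1-θ/2))^2))) ≤
      x^θ * ((m+1+l) * (m*x^(1-θ/2)+√(l^2-m^2*(1-(x^(1-θ/2))^2)))) := by
    rcases lt_or_gt_of_ne hl0 with h | h
    · have := turan_key_neg (-l) m (x^(1-θ/2)) (by linarith) (by linarith)
        (by rwa [abs_of_neg h] at hm) hc0 hc1 (by rwa [neg_sq])
      rw [← Real.rpow_mul hx0.le, neg_sq] at this
      have e : (1-θ/2)*(4/(-l)) = θ := by
        rw [hθneg h.le]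
        have : 2 - l ≠ 0 := by linarith
        field_simp; ring
      rw [e] at this
      simpa [sub_neg_eq_add] using this
    · have := turan_key_pos l m (x^(1-θ/2)) h (by rwa [abs_of_pos h] at hm) hc0 hc1 hcc
      rw [← Real.rpow_mul hx0.le] at this
      have e : (1-θ/2)*(1/l) = θ := by
        rw [hθpos h.le]
        field_simp; ring
      rwa [e] at this
  have h2 := mul_le_mul_of_nonneg_left main hs.le
  have e3 : ∀ k S : ℝ, k*x + x^(θ/2)*S = x^(θ/2)*(k*x^(1-θ/2)+S) := by
    intro k S; nth_rewrite 1 [hxx]; ring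
  rw [e3, e3]
  linarith

/-- step: passing from `b ≥ r a` to the next ratio -/
lemma turan_step (l k x q a b z : ℝ) (hk : 0 ≤ k) (hkl : 0 < k + 2*l) (hq : 0 < q) (hx : 0 < x)
    (hcrit : 0 ≤ (k+l)^2*x^2-((k+l)^2-l^2)*q) (ha : 0 ≤ a) (hm : 0 ≤ k + l)
    (hz : (k+2*l)*z = 2*(k+l)*x*b - k*a)
    (hb : ((k+l)*x+√((k+l)^2*x^2-((k+l)^2-l^2)*q))*a ≤ q*(k+2*l)*b) :
    ((k+l)*x+√((k+l)^2*x^2-((k+l)^2-l^2)*q))*b ≤ (k+2*l)*z ∧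
    0 ≤ q*b^2 - a*z := by
  have t0 := Real.sqrt_nonneg ((k+l)^2*x^2-((k+l)^2-l^2)*q)
  have t2 := Real.sq_sqrt hcrit
  set T := √((k+l)^2*x^2-((k+l)^2-l^2)*q) with hT
  have hA : 0 < q*(k+2*l) := by positivity
  have hmx : 0 ≤ (k+l)*x := by positivity
  have hTm : T ≤ (k+l)*x := by
    apply abs_le_of_sq_le_sq' _ hmx |>.2
    have : 0 ≤ k*(k+2*l)*q := by positivity
    nlinarith
  constructor
  · rw [hz]
    have h1 := mul_le_mul_of_nonneg_left hb (sub_nonneg.2 hTm)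
    have h2 : q*(k+2*l)*(k*a) ≤ q*(k+2*l)*(((k+l)*x-T)*b) := by nlinarith
    have h3 := le_of_mul_le_mul_left h2 hA
    linarith
  · have h1 : 0 ≤ (q*(k+2*l)*b - (k+l)*x*a - T*a)*(q*(k+2*l)*b - (k+l)*x*a + T*a) := by
      apply mul_nonneg
      · linarith
      · nlinarith [mul_nonneg t0 ha]
    have h2 : (q*(k+2*l)*b - (k+l)*x*a - T*a)*(q*(k+2*l)*b - (k+l)*x*a + T*a)
        = q*(k+2*l)*((k+2*l)*(q*b^2-a*z)) := by
      have e : (k+2*l)*(q*b^2-a*z) = (k+2*l)*q*b^2 - a*(2*(k+l)*x*b - k*a) := by rw [← hz]; ring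
      rw [e]
      linear_combination (-a^2)*t2
    rw [h2] at h1
    have h3 := nonneg_of_mul_nonneg_right h1 hA
    exact nonneg_of_mul_nonneg_right h3 hkl

set_option maxHeartbeats 1600000 in
lemma turan_core (l : ℝ) (hl : -1/2 < l) (u : ℕ → ℝ) (x : ℝ) (hx0 : 0 < x) (hx1 : x ≤ 1)
    (h0 : u 0 = 1) (h1 : u 1 = x)
    (hrec : ∀ n : ℕ, ((n : ℝ) + 1 + 2 * l) * u (n + 2)
      = 2 * ((n : ℝ) + 1 + l) * x * u (n+1) - ((n : ℝ)+1) * u n)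
    (θ : ℝ)
    (hθneg : l ≤ 0 → θ = 4 / (2 - l))
    (hθpos : 0 ≤ l → θ = 2 / (1 + 2 * l)) (n : ℕ) :
    0 ≤ x^θ * (u (n+1))^2 - u n * u (n+2) := by
  have hq : 0 < x^θ := Real.rpow_pos_of_pos hx0 _
  have hθ2 : θ ≤ 2 := by
    rcases le_total l 0 with h | h
    · rw [hθneg h, div_le_iff₀ (by linarith)]; linarith
    · rw [hθpos h, div_le_iff₀ (by linarith)]; linarith
  have hqx : x^2 ≤ x^θ := by
    rw [← Real.rpow_two]; exact Real.rpow_le_rpow_of_exponent_ge hx0 hx1 hθ2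
  have hn : ∀ k : ℕ, 0 < (k:ℝ) + 1 + 2*l := fun k => by
    have : (0:ℝ) ≤ k := k.cast_nonneg
    linarith
  have hm' : ∀ k : ℕ, |l| ≤ (k:ℝ) + 1 + l := fun k => by
    have : (0:ℝ) ≤ k := k.cast_nonneg
    rcases abs_cases l with h | h <;> linarith
  by_cases hcrit : (n+1+l)^2*x^2-((n+1+l)^2-l^2)*x^θ ≤ 0
  · -- non critical
    have hA : 0 < x^θ*((n:ℝ)+1+2*l) := mul_pos hq (hn n)
    have e : ((n:ℝ)+1+2*l)*(x^θ * (u (n+1))^2 - u n * u (n+2)) =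
      ((n:ℝ)+1+2*l)*x^θ*(u (n+1))^2 - u n * (2 * ((n : ℝ) + 1 + l) * x * u (n+1) - ((n : ℝ)+1) * u n) := by
      rw [← hrec]; ring
    have h2 : 0 ≤ x^θ*((n:ℝ)+1+2*l)*(((n:ℝ)+1+2*l)*(x^θ * (u (n+1))^2 - u n * u (n+2))) := by
      rw [e]
      nlinarith [sq_nonneg (x^θ*((n:ℝ)+1+2*l)*u (n+1) - ((n:ℝ)+1+l)*x*u n),
        mul_nonneg (sq_nonneg (u n)) (neg_nonneg.2 hcrit)]
    exact nonneg_of_mul_nonneg_right (nonneg_of_mul_nonneg_right h2 hA) (hn n)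
  push Not at hcrit
  have hl0 : l ≠ 0 := by
    rintro rfl
    nlinarith [mul_nonneg (sq_nonneg ((n:ℝ)+1+0)) (sub_nonneg.2 hqx)]
  have hcr : ∀ m : ℝ, 0 ≤ m → m ≤ n+1+l → 0 ≤ m^2*x^2-(m^2-l^2)*x^θ := by
    intro m h h'
    have : m^2 ≤ (n+1+l)^2 := by nlinarith
    nlinarith [mul_le_mul_of_nonneg_right this (sub_nonneg.2 hqx)]
  let T : ℝ → ℝ := fun m => √(m^2*x^2-(m^2-l^2)*x^θ)
  have hkey : ∀ m : ℝ, |l| ≤ m → m + 1 ≤ n+1+l →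
      (m+l)*((m+1)*x+T (m+1)) ≤ x^θ * ((m+1+l)*(m*x+T m)) := by
    intro m h h'
    have := abs_nonneg l
    exact turan_key l m x θ hl hl0 h hθneg hθpos hx0 hx1 (hcr _ (by linarith) h')
  -- transfer of ratio bound
  have htrans : ∀ m a b : ℝ, |l| ≤ m → 0 < m + l → m + 1 ≤ n+1+l → 0 ≤ a →
      (m*x+T m)*a ≤ (m+l)*b → ((m+1)*x+T (m+1))*a ≤ x^θ*(m+1+l)*b := by
    intro m a b h h3 h' ha hb
    have k1 := mul_le_mul_of_nonneg_right (hkey m h h') ha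
    have k2 := mul_le_mul_of_nonneg_left hb (by nlinarith : 0 ≤ x^θ*(m+1+l))
    have k3 : (m+l)*(((m+1)*x+T (m+1))*a) ≤ (m+l)*(x^θ*(m+1+l)*b) := by nlinarith
    exact le_of_mul_le_mul_left k3 h3
  have hstep : ∀ (k : ℕ) (a b z : ℝ), k ≤ n → 0 ≤ a →
      ((k:ℝ)+1+2*l)*z = 2*((k:ℝ)+1+l)*x*b - ((k:ℝ)+1)*a →
      (((k:ℝ)+1+l)*x+T ((k:ℝ)+1+l))*a ≤ x^θ*((k:ℝ)+1+2*l)*b →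
      (((k:ℝ)+1+l)*x+T ((k:ℝ)+1+l))*b ≤ ((k:ℝ)+1+2*l)*z ∧ 0 ≤ x^θ*b^2-a*z := by
    intro k a b z hk ha hz hb
    have hk' : (k:ℝ) ≤ n := by exact_mod_cast hk
    have hm0 : 0 ≤ (k:ℝ)+1+l := (abs_nonneg l).trans (hm' k)
    exact turan_step l (k+1) x (x^θ) a b z (by positivity) (hn k) hq hx0
      (hcr _ hm0 (by linarith)) ha hm0 hz hb
  rcases lt_or_gt_of_ne hl0 with h | h
  · -- negative case
    have hT0 : ∀ m, 0 ≤ T m := fun m => Real.sqrt_nonneg _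
    have inv : ∀ k : ℕ, k ≤ n + 1 → (0 < u k ∧ u (k+1) ≤ x * u k ∧ (∀ j, k = j+1 → x * u k ≤ u j)) ∨
        (∃ j, k = j + 1 ∧ u k ≤ 0 ∧ u (k+1) < 0 ∧
          (((k:ℝ)+l)*x+T ((k:ℝ)+l))*(-u k) ≤ ((k:ℝ)+2*l)*(-u (k+1)) ∧
          0 ≤ x^θ * (u (j+1))^2 - u j * u (j+2)) := by
      intro k
      induction k with
      | zero =>
        intro _
        left
        refine ⟨by rw [h0]; norm_num, by rw [h0, h1]; simp, ?_⟩
        intro j hj; omega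
      | succ k ih =>
        intro hk
        have hr := hrec k
        have hnk := hn k
        have hkn : (0:ℝ) ≤ k := k.cast_nonneg
        have hm0 : 0 ≤ (k:ℝ)+1+l := (abs_nonneg l).trans (hm' k)
        have hkn' : (k:ℝ) ≤ n := by exact_mod_cast (by omega : k ≤ n)
        rcases ih (by omega) with ⟨a1, a2, _⟩ | ⟨j, rfl, a1, a2, a3, _⟩
        · rcases lt_or_ge 0 (u (k+1)) with hp | hp
          · left
            have hxu : x * u (k+1) ≤ u k := by nlinarith
            refine ⟨hp, ?_, ?_⟩
            · have : ((k:ℝ)+1+2*l)*u (k+2) ≤ ((k:ℝ)+1+2*l)*(x*u (k+1)) := by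
                rw [hr]; nlinarith
              exact le_of_mul_le_mul_left this hnk
            · intro j hj
              obtain rfl : k = j := by omega
              exact hxu
          · right
            have hneg : u (k+2) < 0 := by
              have h3 : 2 * ((k : ℝ) + 1 + l) * x * u (k+1) ≤ 0 :=
                mul_nonpos_of_nonneg_of_nonpos (by positivity) hp
              have : ((k:ℝ)+1+2*l)*u (k+2) < 0 := by rw [hr]; nlinarith
              exact neg_of_mul_neg_right this hnk.le
            refine ⟨k, rfl, hp, hneg, ?_, ?_⟩
            · push_cast
              have hTm : T ((k:ℝ)+1+l) ≤ ((k:ℝ)+1+l)*x := by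
                apply Real.sqrt_le_iff.2 ⟨by positivity, ?_⟩
                have : 0 ≤ ((k:ℝ)+1)*((k:ℝ)+1+2*l)*x^θ := by positivity
                nlinarith
              have h4 := mul_le_mul_of_nonneg_right hTm (neg_nonneg.2 hp)
              have h5 : 0 ≤ ((k:ℝ)+1)*u k := by positivity
              have e : ((k:ℝ)+1+2*l)*(-u (k+1+1)) = -(2 * ((k : ℝ) + 1 + l) * x * u (k+1) - ((k : ℝ)+1) * u k) := by
                rw [← hr]; ring
              rw [e]
              linarith
            · have := mul_nonneg hq.le (sq_nonneg (u (k+1)))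
              nlinarith
        · right
          push_cast at a3 hkn hkn' hr hnk hm0
          have hb := htrans ((j:ℝ)+1+l) (-u (j+1)) (-u (j+1+1)) (hm' j)
            (by have := hn j; linarith) (by linarith) (by linarith) (by
              have e : (j:ℝ)+1+l+l = j+1+2*l := by ring
              rw [e]; exact a3)
          have hs := hstep (j+1) (-u (j+1)) (-u (j+1+1)) (-u (j+1+2)) (by omega) (by linarith)
            (by push_cast; linarith) (by
              push_cast
              have e : (j:ℝ)+1+1+l = j+1+l+1 := by ring
              have e2 : (j:ℝ)+1+1+2*l = j+1+l+1+l := by ring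
              rw [e, e2]; exact hb)
          push_cast at hs
          refine ⟨j+1, rfl, a2.le, ?_, by push_cast; exact hs.1, ?_⟩
          · have hM : 0 < ((j:ℝ)+1+1+l)*x+T ((j:ℝ)+1+1+l) := by
              have := hT0 ((j:ℝ)+1+1+l)
              have : 0 < ((j:ℝ)+1+1+l)*x := mul_pos (by linarith [(j.cast_nonneg : (0:ℝ) ≤ j)]) hx0
              linarith
            have := mul_pos hM (neg_pos.2 a2)
            have h6 := pos_of_mul_pos_right (this.trans_le hs.1) (by linarith)
            have : u (j+1+1+1) = u (j+1+2) := rfl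
            linarith
          · have := hs.2
            nlinarith
    rcases inv (n+1) le_rfl with ⟨a1, a2, a3⟩ | ⟨j, hj, _, _, _, a⟩
    · have a3' := a3 n rfl
      have hr := hrec n
      have hnn := hn n
      -- f = (q - x^2) b^2 + ...
      have h5 : 0 ≤ (x^θ - x^2)*(u (n+1))^2 := mul_nonneg (by linarith) (sq_nonneg _)
      suffices u n * u (n+2) ≤ x^2*(u (n+1))^2 by nlinarith
      have hd : 0 ≤ u n - x * u (n+1) := by linarith
      have e : ((n:ℝ)+1+2*l)*(x^2*(u (n+1))^2 - u n * u (n+2)) =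
          ((n:ℝ)+1)*(u n - x*u (n+1))^2 - 2*l*(x*u (n+1))*(u n - x*u (n+1)) := by
        linear_combination (-(u n))*hr
      have h6 : 0 ≤ ((n:ℝ)+1+2*l)*(x^2*(u (n+1))^2 - u n * u (n+2)) := by
        rw [e]
        have : 0 ≤ (-l)*(x*u (n+1))*(u n - x*u (n+1)) :=
          mul_nonneg (mul_nonneg (by linarith) (by positivity)) hd
        have : 0 ≤ ((n:ℝ)+1)*(u n - x*u (n+1))^2 := by positivity
        linarith
      have := nonneg_of_mul_nonneg_right h6 hnn
      linarith
    · obtain rfl : n = j := by omega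
      exact a
  · -- positive case
    have inv : ∀ k : ℕ, k ≤ n → 0 < u k ∧
        (((k:ℝ)+l)*x+T ((k:ℝ)+l))*(u k) ≤ ((k:ℝ)+2*l)*(u (k+1)) := by
      intro k
      induction k with
      | zero =>
        intro _
        have : T l = l*x := by
          simp only [T]
          rw [show l^2*x^2-(l^2-l^2)*x^θ = (l*x)^2 by ring, Real.sqrt_sq (by positivity)]
        simp [h0, h1, this]
        linarith
      | succ k ih =>
        intro hk
        obtain ⟨a1, a2⟩ := ih (by omega)
        have hkn : (0:ℝ) ≤ k := k.cast_nonneg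
        have hkn' : (k:ℝ) ≤ n := by exact_mod_cast (by omega : k ≤ n)
        have hb := htrans ((k:ℝ)+l) (u k) (u (k+1)) (by rw [abs_of_pos h]; linarith) (by linarith)
          (by linarith) a1.le (by
            have e : (k:ℝ)+l+l = k+2*l := by ring
            rw [e]; exact a2)
        have hs := hstep k (u k) (u (k+1)) (u (k+2)) (by omega) a1.le (hrec k) (by
              have e : (k:ℝ)+1+l = k+l+1 := by ring
              have e2 : (k:ℝ)+1+2*l = k+l+1+l := by ring
              rw [e, e2]; exact hb)
        push_cast
        refine ⟨?_, hs.1⟩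
        have hM : 0 < ((k:ℝ)+l)*x+T ((k:ℝ)+l) := by
          have : 0 ≤ T ((k:ℝ)+l) := Real.sqrt_nonneg _
          have : 0 < ((k:ℝ)+l)*x := by positivity
          linarith
        exact pos_of_mul_pos_right ((mul_pos hM a1).trans_le a2) (by linarith)
    obtain ⟨a1, a2⟩ := inv n le_rfl
    have hkn : (0:ℝ) ≤ n := n.cast_nonneg
    have hb := htrans ((n:ℝ)+l) (u n) (u (n+1)) (by rw [abs_of_pos h]; linarith) (by linarith)
      (by linarith) a1.le (by
        have e : (n:ℝ)+l+l = n+2*l := by ring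
        rw [e]; exact a2)
    exact (hstep n (u n) (u (n+1)) (u (n+2)) le_rfl a1.le (hrec n) (by
          have e : (n:ℝ)+1+l = n+l+1 := by ring
          have e2 : (n:ℝ)+1+2*l = n+l+1+l := by ring
          rw [e, e2]; exact hb)).2

theorem ultraspherical_turan_main
    (l : ℝ) (hl : l > -1/2) (y : ℕ → ℝ → ℝ)
    (h0 : ∀ x, y 0 x = 1) (h1 : ∀ x, y 1 x = x)
    (hrec : ∀ n : ℕ, 1 ≤ n → ∀ x : ℝ,
      ((n : ℝ) + 2 * l) * y (n + 1) x = 2 * ((n : ℝ) + l) * x * y n x - (n : ℝ) * y (n - 1) x)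
    (θ : ℝ)
    (hθneg : l ≤ 0 → θ = 4 / (2 - l))
    (hθpos : 0 ≤ l → θ = 2 / (1 + 2 * l))
    (n : ℕ) (hn : 1 ≤ n) (x : ℝ) (hx : |x| ≤ 1) :
    |x| ^ θ * (y n x) ^ 2 - y (n - 1) x * y (n + 1) x ≥ 0 := by
  obtain ⟨k, rfl⟩ : ∃ k, n = k + 1 := ⟨n - 1, by omega⟩
  have hrec' : ∀ n : ℕ, ((n : ℝ) + 1 + 2 * l) * y (n + 2) x
      = 2 * ((n : ℝ) + 1 + l) * x * y (n+1) x - ((n : ℝ)+1) * y n x := by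
    intro n
    have := hrec (n+1) (by omega) x
    push_cast at this
    exact this
  show 0 ≤ |x| ^ θ * (y (k+1) x) ^ 2 - y k x * y (k + 2) x
  rcases lt_trichotomy x 0 with h | h | h
  · rw [abs_of_neg h] at hx ⊢
    have := turan_core l hl (fun j => (-1)^j * y j x) (-x) (by linarith) hx (by simp [h0]) (by simp [h1])
      (by
        intro n
        have := hrec' n
        simp only [pow_succ]
        linear_combination ((-1)^n) * this) θ hθneg hθpos k
    have e : ((-1:ℝ)^k)^2 = 1 := by rw [← pow_mul, mul_comm, pow_mul]; simp
    simp only [pow_succ (-1:ℝ)] at this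
    refine le_trans this (le_of_eq ?_)
    linear_combination ((-x)^θ*(y (k+1) x)^2 - y k x * y (k+2) x) * e
  · subst h
    have hr := hrec' k
    have hk : (0:ℝ) ≤ k := k.cast_nonneg
    have e : ((k:ℝ)+1+2*l)*(-(y k 0 * y (k+2) 0)) = ((k:ℝ)+1)*(y k 0)^2 := by
      linear_combination (-(y k 0))*hr
    have h6 : 0 ≤ ((k:ℝ)+1+2*l)*(-(y k 0 * y (k+2) 0)) := by rw [e]; positivity
    have h7 := nonneg_of_mul_nonneg_right h6 (by linarith)
    have h8 : 0 ≤ |(0:ℝ)|^θ * (y (k+1) 0)^2 := by positivity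
    linarith
  · rw [abs_of_pos h] at hx ⊢
    exact turan_core l hl (fun j => y j x) x h hx (h0 x) (h1 x) hrec' θ hθneg hθpos k
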